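/- (Meyers–Ziemer inequality) For every n ≥ 1 there exists a constant C > 0 depending only on n with the following property: if μ is a Radon measure on ℝ^{n+1} such that 𝔇(μ) := sup{ μ(B_r(x))/rⁿ : x ∈ ℝ^{n+1}, r > 0 } < ∞, then for every φ ∈ C¹_c(ℝ^{n+1}) one has ∫_{ℝ^{n+1}} φ dμ ≤ C · 𝔇(μ) · ∫_{ℝ^{n+1}} |∇φ(x)| dx. -/

import Mathlib

open MeasureTheory Metric
open scoped ENNReal BigOperators

noncomputable section

/-- The half-open lattice cube of side `m` with lowest corner `a`. -/
def latticeCube {ι : Type*} [Fintype ι] [DecidableEq ι] (a : ι → ℤ) (m : ℕ) : Finset (ι → ℤ) :=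
  Fintype.piFinset fun i => Finset.Ico (a i) (a i + m)

/-- The sum of `|f x - f y|` over the lattice edges contained in `latticeCube a m`. -/
def latticeVariation {ι : Type*} [Fintype ι] [DecidableEq ι] (f : (ι → ℤ) → ℝ) (a : ι → ℤ)
    (m : ℕ) : ℝ :=
  ∑ i, ∑ x ∈ latticeCube a m with x i + 1 < a i + m, |f (Function.update x i (x i + 1)) - f x|

section Lattice

variable {ι : Type*} [Fintype ι] [DecidableEq ι]

theorem mem_latticeCube {a x : ι → ℤ} {m : ℕ} :
    x ∈ latticeCube a m ↔ ∀ i, a i ≤ x i ∧ x i < a i + m := by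
  simp [latticeCube]

theorem card_latticeCube (a : ι → ℤ) (m : ℕ) :
    (latticeCube a m).card = m ^ Fintype.card ι := by
  simp [latticeCube]

theorem update_mem_latticeCube {a x : ι → ℤ} {m : ℕ} (hx : x ∈ latticeCube a m) {i : ι} {s : ℤ}
    (hs : a i ≤ s ∧ s < a i + m) : Function.update x i s ∈ latticeCube a m := by
  rw [mem_latticeCube] at hx ⊢
  intro j
  rcases eq_or_ne j i with rfl | hj
  · simpa using hs
  · simpa [hj] using hx j

theorem piecewise_mem_latticeCube {a x y : ι → ℤ} {m : ℕ} (hx : x ∈ latticeCube a m)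
    (hy : y ∈ latticeCube a m) (S : Finset ι) : S.piecewise x y ∈ latticeCube a m := by
  rw [mem_latticeCube] at hx hy ⊢
  intro j
  by_cases hj : j ∈ S
  · simpa [hj] using hx j
  · simpa [hj] using hy j

/-- A cube of side `2m` is the disjoint union of its `2 ^ d` subcubes of side `m`. -/
theorem sum_latticeCube_two_mul (a : ι → ℤ) (m : ℕ) (g : (ι → ℤ) → ℝ) :
    ∑ x ∈ latticeCube a (2 * m), g x =
      ∑ S : Finset ι, ∑ x ∈ latticeCube (fun i => if i ∈ S then a i + m else a i) m, g x := by
  rw [← Finset.sum_fiberwise (latticeCube a (2 * m))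
    (fun x => Finset.univ.filter fun i => a i + m ≤ x i) g]
  refine Finset.sum_congr rfl fun S _ => Finset.sum_congr ?_ fun _ _ => rfl
  ext x
  simp only [Finset.mem_filter, mem_latticeCube, Finset.ext_iff, Finset.mem_univ, true_and,
    ← forall_and]
  refine forall_congr' fun i => ?_
  by_cases hi : i ∈ S <;> simp only [hi, if_true, if_false] <;> push_cast <;> grind

theorem latticeVariation_nonneg (f : (ι → ℤ) → ℝ) (a : ι → ℤ) (m : ℕ) :
    0 ≤ latticeVariation f a m :=
  Finset.sum_nonneg fun _ _ => Finset.sum_nonneg fun _ _ => abs_nonneg _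

theorem sum_latticeVariation_le (f : (ι → ℤ) → ℝ) (a : ι → ℤ) (m : ℕ) :
    ∑ S : Finset ι, latticeVariation f (fun i => if i ∈ S then a i + m else a i) m ≤
      latticeVariation f a (2 * m) := by
  unfold latticeVariation
  rw [Finset.sum_comm]
  refine Finset.sum_le_sum fun i _ => ?_
  simp only [Finset.sum_filter]
  rw [sum_latticeCube_two_mul]
  refine Finset.sum_le_sum fun S _ => Finset.sum_le_sum fun x _ => ?_
  split_ifs with h1 h2 h3 h3
  any_goals exact le_rfl
  any_goals exact abs_nonneg _
  all_goals exfalso; push_cast at *; grind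

theorem abs_sub_le_sum_Ico (g : ℤ → ℝ) {a b s t : ℤ} (hs : a ≤ s ∧ s < b) (ht : a ≤ t ∧ t < b) :
    |g s - g t| ≤ ∑ r ∈ Finset.Ico a (b - 1), |g (r + 1) - g r| := by
  wlog hst : s ≤ t generalizing s t
  · rw [abs_sub_comm]
    exact this ht hs (le_of_not_ge hst)
  have key : ∀ t, s ≤ t → |g s - g t| ≤ ∑ r ∈ Finset.Ico s t, |g (r + 1) - g r| := by
    intro t hst
    induction t, hst using Int.leInduction with
    | base => simp
    | succ t hst ih =>
      rw [← Finset.insert_Ico_right_eq_Ico_add_one hst, Finset.sum_insert (by simp)]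
      have := abs_sub_le (g s) (g t) (g (t + 1))
      rw [abs_sub_comm (g t)] at this
      linarith
  refine (key t hst).trans (Finset.sum_le_sum_of_subset_of_nonneg ?_ fun _ _ _ => abs_nonneg _)
  exact Finset.Ico_subset_Ico hs.1 (by omega)

theorem sum_sum_update_eq (f : (ι → ℤ) → ℝ) (a : ι → ℤ) (m : ℕ) (i : ι) :
    ∑ u ∈ latticeCube a m, ∑ r ∈ Finset.Ico (a i) (a i + m - 1),
        |f (Function.update u i (r + 1)) - f (Function.update u i r)| =
      m * ∑ x ∈ latticeCube a m with x i + 1 < a i + m,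
        |f (Function.update x i (x i + 1)) - f x| := by
  have hcard : (m : ℝ) = ∑ _s ∈ Finset.Ico (a i) (a i + m), (1 : ℝ) := by simp
  rw [hcard, Finset.sum_mul_sum, ← Finset.sum_product', ← Finset.sum_product']
  refine Finset.sum_nbij' (fun p => (p.1 i, Function.update p.1 i p.2))
    (fun q => (Function.update q.2 i q.1, q.2 i)) ?_ ?_ ?_ ?_ ?_
  · rintro ⟨u, r⟩ h
    simp only [Finset.mem_product, Finset.mem_Ico, Finset.mem_filter] at h ⊢
    refine ⟨mem_latticeCube.1 h.1 i, update_mem_latticeCube h.1 ⟨h.2.1, by omega⟩, ?_⟩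
    simp; omega
  · rintro ⟨s, x⟩ h
    simp only [Finset.mem_product, Finset.mem_Ico, Finset.mem_filter] at h ⊢
    exact ⟨update_mem_latticeCube h.2.1 h.1, (mem_latticeCube.1 h.2.1 i).1, by omega⟩
  · rintro ⟨u, r⟩ _; simp
  · rintro ⟨s, x⟩ _; simp
  · rintro ⟨u, r⟩ _; simp

/-- The discrete Poincaré inequality, with the coordinates in `S` exchanged. -/
theorem sum_sum_abs_sub_piecewise_le (f : (ι → ℤ) → ℝ) (a : ι → ℤ) (m : ℕ) (S : Finset ι) :
    ∑ x ∈ latticeCube a m, ∑ y ∈ latticeCube a m, |f x - f (S.piecewise y x)| ≤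
      (latticeCube a m).card * m * ∑ i ∈ S, ∑ x ∈ latticeCube a m with x i + 1 < a i + m,
        |f (Function.update x i (x i + 1)) - f x| := by
  induction S using Finset.induction_on with
  | empty => simp
  | insert i S hi ih =>
    rw [Finset.sum_insert hi, mul_add]
    have hswap : ∑ x ∈ latticeCube a m, ∑ y ∈ latticeCube a m,
          |f (S.piecewise y x) - f (Function.update (S.piecewise y x) i (y i))| =
        ∑ u ∈ latticeCube a m, ∑ v ∈ latticeCube a m, |f u - f (Function.update u i (v i))| := by
      rw [← Finset.sum_product', ← Finset.sum_product']
      refine Finset.sum_nbij' (fun p => (S.piecewise p.2 p.1, S.piecewise p.1 p.2))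
        (fun p => (S.piecewise p.2 p.1, S.piecewise p.1 p.2)) ?_ ?_ ?_ ?_ ?_
      · rintro ⟨x, y⟩ h
        rw [Finset.mem_product] at h ⊢
        exact ⟨piecewise_mem_latticeCube h.2 h.1 S, piecewise_mem_latticeCube h.1 h.2 S⟩
      · rintro ⟨x, y⟩ h
        rw [Finset.mem_product] at h ⊢
        exact ⟨piecewise_mem_latticeCube h.2 h.1 S, piecewise_mem_latticeCube h.1 h.2 S⟩
      · rintro ⟨x, y⟩ _; ext j <;> by_cases hj : j ∈ S <;> simp [hj]
      · rintro ⟨x, y⟩ _; ext j <;> by_cases hj : j ∈ S <;> simp [hj]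
      · rintro ⟨x, y⟩ _; simp [hi]
    have hline : ∑ u ∈ latticeCube a m, ∑ v ∈ latticeCube a m,
          |f u - f (Function.update u i (v i))| ≤
        (latticeCube a m).card * m * ∑ x ∈ latticeCube a m with x i + 1 < a i + m,
          |f (Function.update x i (x i + 1)) - f x| := by
      rw [mul_assoc, ← sum_sum_update_eq, Finset.mul_sum]
      refine Finset.sum_le_sum fun u hu => ?_
      rw [← nsmul_eq_mul]
      refine Finset.sum_le_card_nsmul _ _ _ fun v hv => ?_
      have := abs_sub_le_sum_Ico (fun s => f (Function.update u i s))
        (mem_latticeCube.1 hu i) (mem_latticeCube.1 hv i)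
      simpa using this
    have htri : ∑ x ∈ latticeCube a m, ∑ y ∈ latticeCube a m,
          |f x - f ((insert i S).piecewise y x)| ≤
        ∑ x ∈ latticeCube a m, ∑ y ∈ latticeCube a m, |f x - f (S.piecewise y x)| +
        ∑ x ∈ latticeCube a m, ∑ y ∈ latticeCube a m,
          |f (S.piecewise y x) - f (Function.update (S.piecewise y x) i (y i))| := by
      simp only [← Finset.sum_add_distrib]
      refine Finset.sum_le_sum fun x _ => Finset.sum_le_sum fun y _ => ?_
      rw [Finset.piecewise_insert]
      exact abs_sub_le _ _ _
    linarith [hswap.le]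

/-- The discrete Poincaré inequality on a lattice cube. -/
theorem sum_sum_abs_sub_le (f : (ι → ℤ) → ℝ) (a : ι → ℤ) (m : ℕ) :
    ∑ x ∈ latticeCube a m, ∑ y ∈ latticeCube a m, |f x - f y| ≤
      (latticeCube a m).card * m * latticeVariation f a m := by
  simpa [latticeVariation] using sum_sum_abs_sub_piecewise_le f a m Finset.univ

/-- The discrete relative isoperimetric inequality. -/
theorem card_filter_le_latticeVariation (E : Set (ι → ℤ)) [DecidablePred (· ∈ E)] (a : ι → ℤ)
    {m : ℕ} (hm : 0 < m)
    (hE : 2 * ((latticeCube a m).filter (· ∈ E)).card ≤ (latticeCube a m).card) :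
    (((latticeCube a m).filter (· ∈ E)).card : ℝ) ≤
      m * latticeVariation (E.indicator 1) a m := by
  set Q := latticeCube a m with hQ
  have hpos : (0 : ℝ) < Q.card := by
    rw [hQ, card_latticeCube]; positivity
  have hP := sum_sum_abs_sub_le (E.indicator 1) a m
  rw [← hQ] at hP
  have hsplit : (Q.card : ℝ) = (Q.filter (· ∈ E)).card + (Q.filter (· ∉ E)).card := by
    exact_mod_cast (Finset.card_filter_add_card_filter_not (s := Q) (· ∈ E)).symm
  have hE' : 2 * ((Q.filter (· ∈ E)).card : ℝ) ≤ Q.card := by exact_mod_cast hE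
  have hsum : ∑ x ∈ Q, ∑ y ∈ Q, |E.indicator (1 : (ι → ℤ) → ℝ) x - E.indicator 1 y| =
      2 * ((Q.filter (· ∈ E)).card * (Q.filter (· ∉ E)).card) := by
    have hx : ∀ x ∈ Q, ∑ y ∈ Q, |E.indicator (1 : (ι → ℤ) → ℝ) x - E.indicator 1 y| =
        if x ∈ E then ((Q.filter (· ∉ E)).card : ℝ) else (Q.filter (· ∈ E)).card := by
      intro x _
      by_cases h : x ∈ E
      · rw [if_pos h, Finset.card_filter, Nat.cast_sum]
        refine Finset.sum_congr rfl fun y _ => ?_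
        by_cases hy : y ∈ E <;> simp [h, hy]
      · rw [if_neg h, Finset.card_filter, Nat.cast_sum]
        refine Finset.sum_congr rfl fun y _ => ?_
        by_cases hy : y ∈ E <;> simp [h, hy]
    rw [Finset.sum_congr rfl hx, Finset.sum_ite]
    simp only [Finset.sum_const, nsmul_eq_mul]
    ring
  rw [hsum] at hP
  have h1 : (Q.card : ℝ) * (Q.filter (· ∈ E)).card ≤
      2 * ((Q.filter (· ∈ E)).card * (Q.filter (· ∉ E)).card) := by
    nlinarith [Nat.cast_nonneg (α := ℝ) (Q.filter (· ∈ E)).card]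
  refine le_of_mul_le_mul_left ?_ hpos
  linarith

/-- A discrete boxing inequality for sets. -/
theorem sum_weight_le_latticeVariation_indicator {n : ℕ} (hd : Fintype.card ι = n + 1)
    {w : (ι → ℤ) → ℝ} (hw : ∀ x, 0 ≤ w x) {A : ℝ}
    (hA : ∀ a k, ∑ x ∈ latticeCube a (2 ^ k), w x ≤ A * (2 ^ k) ^ n) (E : Set (ι → ℤ))
    [DecidablePred (· ∈ E)] (k : ℕ) : ∀ a : ι → ℤ,
    2 * ((latticeCube a (2 ^ k)).filter (· ∈ E)).card ≤ (latticeCube a (2 ^ k)).card →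
    ∑ x ∈ latticeCube a (2 ^ k), E.indicator w x ≤
      2 ^ (n + 2) * A * latticeVariation (E.indicator 1) a (2 ^ k) := by
  have hA0 : 0 ≤ A := by
    have := (Finset.sum_nonneg fun x _ => hw x).trans (hA 0 0)
    simpa using this
  induction k with
  | zero =>
    intro a h
    rw [card_latticeCube, pow_zero, one_pow] at h
    have h0 : (latticeCube a 1).filter (· ∈ E) = ∅ := Finset.card_eq_zero.1 (by omega)
    have : ∑ x ∈ latticeCube a (2 ^ 0), E.indicator w x = 0 := by
      refine Finset.sum_eq_zero fun x hx => Set.indicator_of_notMem ?_ _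
      exact Finset.filter_eq_empty_iff.1 h0 hx
    rw [this]
    have := latticeVariation_nonneg (E.indicator 1) a (2 ^ 0)
    positivity
  | succ k ih =>
    intro a h
    rw [pow_succ' 2 k] at h ⊢
    by_cases hall : ∀ S : Finset ι,
        2 * ((latticeCube (fun i => if i ∈ S then a i + ((2 ^ k : ℕ) : ℤ) else a i)
          (2 ^ k)).filter (· ∈ E)).card ≤ (2 ^ k) ^ Fintype.card ι
    · rw [sum_latticeCube_two_mul]
      calc _ ≤ ∑ S : Finset ι, 2 ^ (n + 2) * A * latticeVariation (E.indicator 1)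
              (fun i => if i ∈ S then a i + ((2 ^ k : ℕ) : ℤ) else a i) (2 ^ k) :=
            Finset.sum_le_sum fun S _ => ih _ (by rw [card_latticeCube]; exact hall S)
        _ ≤ _ := by
            rw [← Finset.mul_sum]
            exact mul_le_mul_of_nonneg_left (sum_latticeVariation_le _ _ _) (by positivity)
    · push Not at hall
      obtain ⟨S, hS⟩ := hall
      have hiso := card_filter_le_latticeVariation E a (by positivity) h
      have hsub : ((latticeCube (fun i => if i ∈ S then a i + ((2 ^ k : ℕ) : ℤ) else a i)
          (2 ^ k)).filter (· ∈ E)).card ≤ ((latticeCube a (2 * 2 ^ k)).filter (· ∈ E)).card := by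
        refine Finset.card_le_card (Finset.filter_subset_filter _ fun x hx => ?_)
        rw [mem_latticeCube] at hx ⊢
        intro i
        have := hx i
        by_cases hi : i ∈ S <;> simp only [hi, if_true, if_false] at this <;> push_cast at * <;>
          grind
      have h1 : ((2 : ℝ) ^ k) ^ (n + 1) ≤
          2 * (2 * 2 ^ k * latticeVariation (E.indicator 1) a (2 * 2 ^ k)) := by
        have h2 : ((2 : ℝ) ^ k) ^ (n + 1) ≤
            2 * (((latticeCube a (2 * 2 ^ k)).filter (· ∈ E)).card : ℝ) := by
          rw [hd] at hS
          exact_mod_cast hS.le.trans (Nat.mul_le_mul_left 2 hsub)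
        push_cast at hiso
        linarith
      have h3 : ((2 : ℝ) ^ k) ^ n ≤ 4 * latticeVariation (E.indicator 1) a (2 * 2 ^ k) := by
        have : (0 : ℝ) < 2 ^ k := by positivity
        refine le_of_mul_le_mul_left ?_ this
        rw [pow_succ] at h1
        linarith
      have h4 := hA a (k + 1)
      rw [pow_succ' 2 k, pow_succ' 2 k, mul_pow] at h4
      calc _ ≤ ∑ x ∈ latticeCube a (2 * 2 ^ k), w x :=
            Finset.sum_le_sum fun x _ => Set.indicator_le_self' (fun _ _ => hw _) x
        _ ≤ _ := h4
        _ ≤ A * (2 ^ n * (4 * latticeVariation (E.indicator 1) a (2 * 2 ^ k))) := by gcongr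
        _ = _ := by ring

theorem integral_indicator_Iic_one {M c : ℝ} (hc : c ∈ Set.Icc 0 M) :
    ∫ t in (0 : ℝ)..M, (Set.Iic c).indicator (1 : ℝ → ℝ) t = c := by
  have := intervalIntegral.integral_indicator (μ := volume) (f := (1 : ℝ → ℝ)) hc
  rw [show Set.Iic c = {x | x ≤ c} from rfl, this]
  simp

theorem intervalIntegrable_indicator_Iic_one (M c : ℝ) :
    IntervalIntegrable ((Set.Iic c).indicator (1 : ℝ → ℝ)) volume 0 M := by
  rw [intervalIntegrable_iff]
  exact (intervalIntegrable_iff.1 intervalIntegrable_const).indicator measurableSet_Iic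

theorem intervalIntegrable_finsetSum {κ : Type*} (s : Finset κ) {g : κ → ℝ → ℝ} {a b : ℝ}
    (hg : ∀ i ∈ s, IntervalIntegrable (g i) volume a b) :
    IntervalIntegrable (fun t => ∑ i ∈ s, g i t) volume a b := by
  simpa only [Finset.sum_fn] using IntervalIntegrable.sum s hg

theorem abs_indicator_Iic_sub (a b t : ℝ) :
    |(Set.Iic a).indicator (1 : ℝ → ℝ) t - (Set.Iic b).indicator 1 t| =
      (Set.Iic (max a b)).indicator 1 t - (Set.Iic (min a b)).indicator 1 t := by
  rcases le_total a b with h | h <;>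
  by_cases ha : t ≤ a <;> by_cases hb : t ≤ b <;> simp [Set.indicator, ha, hb, h] <;> grind

/-- A discrete Meyers–Ziemer inequality. -/
theorem sum_mul_weight_le_latticeVariation {n : ℕ} (hd : Fintype.card ι = n + 1)
    {w : (ι → ℤ) → ℝ} (hw : ∀ x, 0 ≤ w x) {A : ℝ}
    (hA : ∀ a k, ∑ x ∈ latticeCube a (2 ^ k), w x ≤ A * (2 ^ k) ^ n) {f : (ι → ℤ) → ℝ}
    (hf : ∀ x, 0 ≤ f x) (a : ι → ℤ) (k : ℕ)
    (hsupp : 2 * ((latticeCube a (2 ^ k)).filter fun x => 0 < f x).card ≤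
      (latticeCube a (2 ^ k)).card) :
    ∑ x ∈ latticeCube a (2 ^ k), f x * w x ≤
      2 ^ (n + 2) * A * latticeVariation f a (2 ^ k) := by
  classical
  set Q := latticeCube a (2 ^ k) with hQ
  set M := ∑ x ∈ Q, f x with hM
  have hfM : ∀ x ∈ Q, f x ∈ Set.Icc 0 M := fun x hx =>
    ⟨hf x, Finset.single_le_sum (fun y _ => hf y) hx⟩
  have hM0 : 0 ≤ M := Finset.sum_nonneg fun x _ => hf x
  have hmem : ∀ i, ∀ x ∈ Q.filter (fun x => x i + 1 < a i + (2 ^ k : ℕ)),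
      Function.update x i (x i + 1) ∈ Q := by
    intro i x hx
    rw [Finset.mem_filter] at hx
    have := (mem_latticeCube.1 hx.1 i).1
    exact update_mem_latticeCube hx.1 ⟨by omega, hx.2⟩
  have hI := intervalIntegrable_indicator_Iic_one M
  have hind : ∀ t x, {x | t ≤ f x}.indicator (1 : (ι → ℤ) → ℝ) x =
      (Set.Iic (f x)).indicator 1 t := fun t x => by
    by_cases h : t ≤ f x <;> simp [Set.indicator, h]
  have hindw : ∀ t x, {x | t ≤ f x}.indicator w x =
      (Set.Iic (f x)).indicator 1 t * w x := fun t x => by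
    by_cases h : t ≤ f x <;> simp [Set.indicator, h]
  have hvar : ∀ t, latticeVariation ({x | t ≤ f x}.indicator 1) a (2 ^ k) =
      ∑ i, ∑ x ∈ Q.filter (fun x => x i + 1 < a i + (2 ^ k : ℕ)),
        ((Set.Iic (max (f (Function.update x i (x i + 1))) (f x))).indicator (1 : ℝ → ℝ) t -
          (Set.Iic (min (f (Function.update x i (x i + 1))) (f x))).indicator 1 t) := fun t => by
    simp only [latticeVariation, hind, abs_indicator_Iic_sub, hQ]
  have hIV : ∀ i, ∀ x, IntervalIntegrable (fun t =>
      (Set.Iic (max (f (Function.update x i (x i + 1))) (f x))).indicator (1 : ℝ → ℝ) t -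
          (Set.Iic (min (f (Function.update x i (x i + 1))) (f x))).indicator 1 t) volume 0 M :=
    fun i x => (hI _).sub (hI _)
  have hleft : ∫ t in (0 : ℝ)..M, ∑ x ∈ Q, {x | t ≤ f x}.indicator w x = ∑ x ∈ Q, f x * w x := by
    simp only [hindw]
    rw [intervalIntegral.integral_finsetSum fun x _ => (hI (f x)).mul_const (w x)]
    refine Finset.sum_congr rfl fun x hx => ?_
    rw [intervalIntegral.integral_mul_const, integral_indicator_Iic_one (hfM x hx)]
  have hright : ∫ t in (0 : ℝ)..M, latticeVariation ({x | t ≤ f x}.indicator 1) a (2 ^ k) =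
      latticeVariation f a (2 ^ k) := by
    simp only [hvar]
    rw [intervalIntegral.integral_finsetSum fun i _ =>
      intervalIntegrable_finsetSum _ fun x _ => hIV i x]
    refine Finset.sum_congr rfl fun i _ => ?_
    rw [intervalIntegral.integral_finsetSum fun x _ => hIV i x]
    refine Finset.sum_congr rfl fun x hx => ?_
    have h1 := hfM _ (hmem i x hx)
    have h2 := hfM x (Finset.mem_filter.1 hx).1
    rw [intervalIntegral.integral_sub (hI _) (hI _), integral_indicator_Iic_one,
      integral_indicator_Iic_one, max_sub_min_eq_abs']
    · exact ⟨le_min h1.1 h2.1, min_le_of_left_le h1.2⟩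
    · exact ⟨le_max_of_le_left h1.1, max_le h1.2 h2.2⟩
  rw [← hleft, ← hright, ← intervalIntegral.integral_const_mul]
  refine intervalIntegral.integral_mono_on_of_le_Ioo hM0 ?_ ?_ fun t ht => ?_
  · simp only [hindw]
    exact intervalIntegrable_finsetSum _ fun x _ => (hI (f x)).mul_const (w x)
  · simp only [hvar]
    exact (intervalIntegrable_finsetSum _ fun i _ => intervalIntegrable_finsetSum _ fun x _ =>
      hIV i x).const_mul _
  · refine sum_weight_le_latticeVariation_indicator hd hw hA _ k a (le_trans ?_ hsupp)
    refine Nat.mul_le_mul_left 2 (Finset.card_le_card fun x hx => ?_)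
    rw [Finset.mem_filter] at hx ⊢
    exact ⟨hx.1, ht.1.trans_le hx.2⟩

end Lattice

/-- The index of the cell containing `p` in the grid of mesh `δ` with a vertex at `(-R, …, -R)`. -/
def gridIndex {ι : Type*} (δ R : ℝ) (p : EuclideanSpace ℝ ι) : ι → ℤ :=
  fun i => ⌊(p i + R) / δ⌋

section Grid

variable {ι : Type*} {δ : ℝ}

theorem measurable_gridIndex (δ R : ℝ) :
    Measurable (gridIndex δ R : EuclideanSpace ℝ ι → ι → ℤ) := by
  refine measurable_pi_iff.2 fun i => Int.measurable_floor.comp ?_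
  fun_prop

theorem gridIndex_eq_iff (hδ : 0 < δ) {R : ℝ} {p : EuclideanSpace ℝ ι} {x : ι → ℤ} :
    gridIndex δ R p = x ↔ ∀ i, x i * δ - R ≤ p i ∧ p i < (x i + 1) * δ - R := by
  rw [funext_iff]
  refine forall_congr' fun i => ?_
  rw [gridIndex, Int.floor_eq_iff, le_div_iff₀ hδ, div_lt_iff₀ hδ]
  constructor <;> rintro ⟨h1, h2⟩ <;> constructor <;> linarith

theorem gridIndex_add_single [DecidableEq ι] (hδ : 0 < δ) (R : ℝ) (p : EuclideanSpace ℝ ι) (i : ι) :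
    gridIndex δ R (p + EuclideanSpace.single i δ) =
      Function.update (gridIndex δ R p) i (gridIndex δ R p i + 1) := by
  ext j
  rcases eq_or_ne j i with rfl | hj
  · simp only [gridIndex, PiLp.add_apply, PiLp.single_apply, if_true,
      Function.update_self]
    rw [← Int.floor_add_one]
    congr 1
    field_simp
    ring
  · simp [gridIndex, hj]

variable [Fintype ι]

theorem dist_le_card_mul {p q : EuclideanSpace ℝ ι} {c : ℝ} (h : ∀ i, |p i - q i| ≤ c) :
    dist p q ≤ Fintype.card ι * c := by
  have h1 : dist p q ≤ ∑ i, |p i - q i| := by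
    rw [EuclideanSpace.dist_eq]
    refine Real.sqrt_le_iff.2 ⟨Finset.sum_nonneg fun i _ => abs_nonneg _, ?_⟩
    simp only [Real.dist_eq]
    exact Finset.sum_sq_le_sq_sum_of_nonneg fun i _ => abs_nonneg _
  refine h1.trans ((Finset.sum_le_card_nsmul _ _ c fun i _ => h i).trans_eq ?_)
  simp

theorem volume_real_gridIndex_preimage (hδ : 0 < δ) (R : ℝ) (x : ι → ℤ) :
    (volume : Measure (EuclideanSpace ℝ ι)).real (gridIndex δ R ⁻¹' {x}) =
      δ ^ Fintype.card ι := by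
  have hset : (gridIndex δ R ⁻¹' {x} : Set (EuclideanSpace ℝ ι)) =
      (MeasurableEquiv.toLp 2 (ι → ℝ)).symm ⁻¹'
        (Set.univ.pi fun i => Set.Ico (x i * δ - R) ((x i + 1) * δ - R)) := by
    ext p
    simp [gridIndex_eq_iff hδ]
  rw [hset, Measure.real, (EuclideanSpace.volume_preserving_symm_measurableEquiv_toLp
    ι).measure_preimage_equiv, Real.volume_pi_Ico]
  simp only [show ∀ i, (x i + 1) * δ - R - (x i * δ - R) = δ from fun i => by ring]
  simp [ENNReal.toReal_ofReal hδ.le]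

/-- The average of `g` over the grid cell of index `x`. -/
def gridAverage (δ R : ℝ) (g : EuclideanSpace ℝ ι → ℝ) (x : ι → ℤ) : ℝ :=
  (δ ^ Fintype.card ι)⁻¹ * ∫ p in gridIndex δ R ⁻¹' {x}, g p

theorem measurableSet_gridIndex_preimage (δ R : ℝ) (x : ι → ℤ) :
    MeasurableSet (gridIndex δ R ⁻¹' {x} : Set (EuclideanSpace ℝ ι)) :=
  measurable_gridIndex δ R (measurableSet_singleton x)

theorem sum_setIntegral_gridIndex_preimage (δ R : ℝ) {μ : Measure (EuclideanSpace ℝ ι)}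
    {g : EuclideanSpace ℝ ι → ℝ} (hg : Integrable g μ) (Q : Finset (ι → ℤ)) :
    ∑ x ∈ Q, ∫ p in gridIndex δ R ⁻¹' {x}, g p ∂μ =
      ∫ p in gridIndex δ R ⁻¹' (Q : Set (ι → ℤ)), g p ∂μ := by
  rw [← integral_biUnion_finset Q (fun x _ => measurableSet_gridIndex_preimage δ R x) ?_
    fun _ _ => hg.integrableOn]
  · congr 2
    ext p
    simp
  · intro x _ y _ hxy
    exact Disjoint.preimage _ (Set.disjoint_singleton.2 hxy)

variable [DecidableEq ι]

theorem gridIndex_mem_latticeCube_iff (hδ : 0 < δ) {R : ℝ} {p : EuclideanSpace ℝ ι} {a : ι → ℤ}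
    {m : ℕ} : gridIndex δ R p ∈ latticeCube a m ↔
      ∀ i, a i * δ - R ≤ p i ∧ p i < (a i + m) * δ - R := by
  rw [mem_latticeCube]
  refine forall_congr' fun i => ?_
  rw [gridIndex, Int.le_floor, Int.floor_lt, le_div_iff₀ hδ, div_lt_iff₀ hδ]
  push_cast
  constructor <;> rintro ⟨h1, h2⟩ <;> constructor <;> linarith

theorem dist_le_of_gridIndex_mem (hδ : 0 < δ) {R : ℝ} {p q : EuclideanSpace ℝ ι} {a : ι → ℤ}
    {m : ℕ} (hp : gridIndex δ R p ∈ latticeCube a m) (hq : gridIndex δ R q ∈ latticeCube a m) :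
    dist p q ≤ Fintype.card ι * (m * δ) := by
  rw [gridIndex_mem_latticeCube_iff hδ] at hp hq
  refine dist_le_card_mul fun i => ?_
  have h1 := hp i
  have h2 := hq i
  rw [abs_le]
  constructor <;> linarith

theorem measureReal_gridIndex_preimage_le (hδ : 0 < δ) (R : ℝ) {μ : Measure (EuclideanSpace ℝ ι)}
    [IsLocallyFiniteMeasure μ] {D : ℝ} {n : ℕ}
    (hμ : ∀ x r, 0 < r → μ.real (ball x r) ≤ D * r ^ n) (a : ι → ℤ) {m : ℕ} (hm : 0 < m) :
    μ.real (gridIndex δ R ⁻¹' (latticeCube a m : Set (ι → ℤ))) ≤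
      D * ((Fintype.card ι + 1) * (m * δ)) ^ n := by
  have hmδ : 0 < m * δ := by positivity
  rcases Set.eq_empty_or_nonempty
    (gridIndex δ R ⁻¹' (latticeCube a m : Set (ι → ℤ)) : Set (EuclideanSpace ℝ ι)) with h | ⟨p, hp⟩
  · rw [h, measureReal_empty]
    exact measureReal_nonneg.trans (hμ 0 _ (by positivity))
  · refine le_trans (measureReal_mono (fun q hq => ?_) measure_ball_lt_top.ne)
      (hμ p _ (by positivity))
    have := dist_le_of_gridIndex_mem hδ hq hp
    rw [mem_ball]
    linarith

theorem finite_gridIndex_preimage (hδ : 0 < δ) (R : ℝ) (μ : Measure (EuclideanSpace ℝ ι))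
    [IsLocallyFiniteMeasure μ] (a : ι → ℤ) (m : ℕ) :
    μ (gridIndex δ R ⁻¹' (latticeCube a m : Set (ι → ℤ))) < ∞ := by
  refine Bornology.IsBounded.measure_lt_top ?_
  exact Metric.isBounded_iff.2 ⟨_, fun p hp q hq => dist_le_of_gridIndex_mem hδ hp hq⟩

theorem finite_gridIndex_preimage_singleton (hδ : 0 < δ) (R : ℝ)
    (μ : Measure (EuclideanSpace ℝ ι)) [IsLocallyFiniteMeasure μ] (x : ι → ℤ) :
    μ (gridIndex δ R ⁻¹' {x}) < ∞ := by
  refine (measure_mono (Set.preimage_mono ?_)).trans_lt (finite_gridIndex_preimage hδ R μ x 1)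
  simp [mem_latticeCube]

theorem gridAverage_update (hδ : 0 < δ) (R : ℝ) (g : EuclideanSpace ℝ ι → ℝ) (x : ι → ℤ) (i : ι) :
    gridAverage δ R g (Function.update x i (x i + 1)) =
      gridAverage δ R (fun p => g (p + EuclideanSpace.single i δ)) x := by
  unfold gridAverage
  rw [← (measurePreserving_add_right volume (EuclideanSpace.single i δ)).setIntegral_preimage_emb
    (measurableEmbedding_addRight _)]
  congr 3
  ext p
  simp only [Set.mem_preimage, Set.mem_singleton_iff, gridIndex_add_single hδ]
  constructor
  · intro h
    have hi := congrFun h i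
    ext j
    rcases eq_or_ne j i with rfl | hj
    · simpa using hi
    · simpa [hj] using congrFun h j
  · rintro rfl
    rfl

theorem latticeVariation_gridAverage_le (hδ : 0 < δ) (R : ℝ) {g : EuclideanSpace ℝ ι → ℝ}
    (hg : Integrable g) {I : ℝ} (hI : ∀ v, ∫ p, |g (p + v) - g p| ≤ ‖v‖ * I) (a : ι → ℤ) (m : ℕ) :
    latticeVariation (gridAverage δ R g) a m ≤
      Fintype.card ι * ((δ ^ Fintype.card ι)⁻¹ * (δ * I)) := by
  unfold latticeVariation
  refine (Finset.sum_le_card_nsmul _ _ ((δ ^ Fintype.card ι)⁻¹ * (δ * I)) fun i _ => ?_).trans_eq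
    (by simp)
  set v : EuclideanSpace ℝ ι := EuclideanSpace.single i δ with hv
  have hvn : ‖v‖ = δ := by simp [hv, abs_of_pos hδ]
  have hgv : Integrable fun p => g (p + v) := hg.comp_add_right v
  have hdiff : Integrable fun p => |g (p + v) - g p| := (hgv.sub hg).abs
  calc ∑ x ∈ latticeCube a m with x i + 1 < a i + m,
        |gridAverage δ R g (Function.update x i (x i + 1)) - gridAverage δ R g x|
      ≤ ∑ x ∈ latticeCube a m with x i + 1 < a i + m,
        (δ ^ Fintype.card ι)⁻¹ * ∫ p in gridIndex δ R ⁻¹' {x}, |g (p + v) - g p| := by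
        refine Finset.sum_le_sum fun x _ => ?_
        rw [gridAverage_update hδ, gridAverage, gridAverage, ← mul_sub,
          ← integral_sub hgv.integrableOn hg.integrableOn, abs_mul, abs_of_nonneg (by positivity)]
        gcongr
        exact abs_integral_le_integral_abs
    _ ≤ _ := by
        rw [← Finset.mul_sum, sum_setIntegral_gridIndex_preimage δ R hdiff]
        gcongr
        refine (setIntegral_le_integral hdiff (Filter.Eventually.of_forall fun p =>
          abs_nonneg _)).trans ((hI v).trans_eq (by rw [hvn]))

/-- If `g` varies by at most `ε` on a grid cell, it exceeds its average there by at most `ε`. -/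
theorem le_gridAverage_add (hδ : 0 < δ) {R : ℝ} {g : EuclideanSpace ℝ ι → ℝ} (hg : Integrable g)
    {ε : ℝ} (hε : ∀ p q, dist p q ≤ Fintype.card ι * δ → g p ≤ g q + ε)
    (p : EuclideanSpace ℝ ι) : g p ≤ gridAverage δ R g (gridIndex δ R p) + ε := by
  have hcell : ∀ q, gridIndex δ R q = gridIndex δ R p → g p - ε ≤ g q := by
    intro q hq
    have := dist_le_of_gridIndex_mem (a := gridIndex δ R p) (m := 1) (R := R) (p := p) (q := q) hδ
      (by simp [mem_latticeCube]) (by simp [mem_latticeCube, hq])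
    linarith [hε p q (by simpa using this)]
  have h1 := setIntegral_ge_of_const_le_real (measurableSet_gridIndex_preimage δ R (gridIndex δ R p))
    (finite_gridIndex_preimage_singleton hδ R volume _).ne hcell hg.integrableOn
  rw [volume_real_gridIndex_preimage hδ] at h1
  have h2 : g p - ε ≤ gridAverage δ R g (gridIndex δ R p) := by
    rw [gridAverage, ← div_eq_inv_mul, le_div_iff₀ (by positivity)]
    exact h1
  linarith

end Grid

/-- The integral of a difference of translates is controlled by the gradient. -/
theorem integral_abs_sub_translate_le {E : Type*} [NormedAddCommGroup E] [NormedSpace ℝ E]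
    [FiniteDimensional ℝ E] [MeasurableSpace E] [BorelSpace E] (ν : Measure E)
    [ν.IsAddHaarMeasure] {φ : E → ℝ} (hφ : ContDiff ℝ 1 φ) (hc : HasCompactSupport φ) (v : E) :
    ∫ p, |φ (p + v) - φ p| ∂ν ≤ ‖v‖ * ∫ p, ‖fderiv ℝ φ p‖ ∂ν := by
  have hdc : Continuous (fderiv ℝ φ) := hφ.continuous_fderiv one_ne_zero
  have hint : Integrable (fun p => ‖fderiv ℝ φ p‖) ν :=
    (hdc.integrable_of_hasCompactSupport (hc.fderiv ℝ)).norm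
  have hpt : ∀ p, ENNReal.ofReal |φ (p + v) - φ p| ≤
      ∫⁻ s in Set.Ioc (0 : ℝ) 1, ENNReal.ofReal (‖v‖ * ‖fderiv ℝ φ (p + s • v)‖) := by
    intro p
    have hder : ∀ s ∈ Set.uIcc (0 : ℝ) 1,
        HasDerivAt (fun s : ℝ => φ (p + s • v)) (fderiv ℝ φ (p + s • v) v) s := by
      intro s _
      have h1 : HasDerivAt (fun s : ℝ => p + s • v) v s := by
        simpa using ((hasDerivAt_id s).smul_const v).const_add p
      exact ((hφ.differentiable one_ne_zero _).hasFDerivAt).comp_hasDerivAt s h1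
    have hcont : Continuous fun s : ℝ => fderiv ℝ φ (p + s • v) v := by fun_prop
    have hFTC := intervalIntegral.integral_eq_sub_of_hasDerivAt hder (hcont.intervalIntegrable 0 1)
    simp only [one_smul, zero_smul, add_zero] at hFTC
    rw [← hFTC, intervalIntegral.integral_of_le zero_le_one, ← Real.enorm_eq_ofReal_abs]
    refine (enorm_integral_le_lintegral_enorm _).trans (lintegral_mono fun s => ?_)
    rw [← ofReal_norm, mul_comm]
    exact ENNReal.ofReal_le_ofReal ((fderiv ℝ φ (p + s • v)).le_opNorm v)
  have hmeas : Continuous (Function.uncurry fun (p : E) (s : ℝ) =>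
      ENNReal.ofReal (‖v‖ * ‖fderiv ℝ φ (p + s • v)‖)) := by
    refine ENNReal.continuous_ofReal.comp (continuous_const.mul (hdc.comp ?_).norm)
    fun_prop
  have hlint : ∫⁻ p, ENNReal.ofReal |φ (p + v) - φ p| ∂ν ≤
      ENNReal.ofReal (‖v‖ * ∫ p, ‖fderiv ℝ φ p‖ ∂ν) := by
    refine (lintegral_mono hpt).trans_eq ?_
    rw [lintegral_lintegral_swap hmeas.measurable.aemeasurable]
    simp only [lintegral_add_right_eq_self (μ := ν) fun q => ENNReal.ofReal (‖v‖ * ‖fderiv ℝ φ q‖)]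
    rw [← ofReal_integral_eq_lintegral_ofReal (hint.const_mul _)
      (Filter.Eventually.of_forall fun p => by positivity), integral_const_mul]
    simp
  have hφv : Continuous fun p => |φ (p + v) - φ p| := by
    have := hφ.continuous
    fun_prop
  rw [integral_eq_lintegral_of_nonneg_ae (Filter.Eventually.of_forall fun p => abs_nonneg _)
    hφv.aestronglyMeasurable]
  exact ENNReal.toReal_le_of_le_ofReal (by positivity) hlint

section MeyersZiemer

variable {ι : Type*} [Fintype ι] [DecidableEq ι] {n : ℕ} {μ : Measure (EuclideanSpace ℝ ι)}
  [IsLocallyFiniteMeasure μ] {D : ℝ} {g : EuclideanSpace ℝ ι → ℝ} {I : ℝ}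

/-- The Meyers–Ziemer inequality for the grid averages of `g` over the cube `[-R, 3R) ^ d`. -/
theorem sum_gridAverage_mul_measureReal_le (hd : Fintype.card ι = n + 1)
    (hμ : ∀ x r, 0 < r → μ.real (ball x r) ≤ D * r ^ n) (hg : Integrable g) (hg0 : ∀ p, 0 ≤ g p)
    (hI : ∀ v, ∫ p, |g (p + v) - g p| ≤ ‖v‖ * I) {R δ : ℝ} (hδ : 0 < δ) (j : ℕ)
    (hj : 2 ^ j * δ = 2 * R) (hsupp : ∀ p, g p ≠ 0 → ∀ i, |p i| < R) :
    ∑ x ∈ latticeCube 0 (2 ^ (j + 1)), gridAverage δ R g x * μ.real (gridIndex δ R ⁻¹' {x}) ≤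
      2 ^ (n + 2) * (n + 2) ^ n * (n + 1) * D * I := by
  have hA : ∀ (a : ι → ℤ) k, ∑ x ∈ latticeCube a (2 ^ k), μ.real (gridIndex δ R ⁻¹' {x}) ≤
      (D * ((n + 2) * δ) ^ n) * (2 ^ k) ^ n := by
    intro a k
    rw [sum_measureReal_preimage_singleton _
      (fun x _ => measurableSet_gridIndex_preimage δ R x)
      (fun x _ => (finite_gridIndex_preimage_singleton hδ R μ x).ne)]
    refine (measureReal_gridIndex_preimage_le hδ R hμ a (by positivity)).trans_eq ?_
    rw [hd, mul_assoc, ← mul_pow]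
    push_cast
    ring
  have hD : 0 ≤ D * ((n + 2) * δ) ^ n := by
    have := (Finset.sum_nonneg fun x _ => measureReal_nonneg).trans (hA 0 0)
    simpa using this
  have hf0 : ∀ x, 0 ≤ gridAverage δ R g x := fun x =>
    mul_nonneg (by positivity) (integral_nonneg hg0)
  have hsub : ((latticeCube (0 : ι → ℤ) (2 ^ (j + 1))).filter fun x => 0 < gridAverage δ R g x) ⊆
      latticeCube 0 (2 ^ j) := by
    intro x hx
    by_contra hxj
    refine (Finset.mem_filter.1 hx).2.ne' ?_
    rw [gridAverage, setIntegral_eq_zero_of_forall_eq_zero, mul_zero]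
    intro p hp
    by_contra hgp
    refine hxj ?_
    rw [← show gridIndex δ R p = x from hp, gridIndex_mem_latticeCube_iff hδ]
    intro i
    have := abs_lt.1 (hsupp p hgp i)
    push_cast
    simp only [Pi.zero_apply, Int.cast_zero, zero_mul, zero_add, hj]
    constructor <;> linarith
  have hcard : 2 * ((latticeCube (0 : ι → ℤ) (2 ^ (j + 1))).filter
      fun x => 0 < gridAverage δ R g x).card ≤ (latticeCube (0 : ι → ℤ) (2 ^ (j + 1))).card := by
    refine (Nat.mul_le_mul_left 2 (Finset.card_le_card hsub)).trans ?_
    rw [card_latticeCube, card_latticeCube, hd, pow_succ 2 j, mul_pow, mul_comm]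
    exact Nat.mul_le_mul_left _ (Nat.le_self_pow (by omega) 2)
  refine (sum_mul_weight_le_latticeVariation hd (fun x => measureReal_nonneg) hA hf0 0 (j + 1)
    hcard).trans ?_
  refine (mul_le_mul_of_nonneg_left (latticeVariation_gridAverage_le hδ R hg hI 0 _)
    (by positivity)).trans_eq ?_
  rw [hd, mul_pow, pow_succ δ]
  push_cast
  field_simp

/-- The Meyers–Ziemer inequality for nonnegative functions whose translates satisfy an
`L¹`-Lipschitz bound. -/
theorem integral_le_of_integral_abs_sub_translate_le (hd : Fintype.card ι = n + 1)
    (hμ : ∀ x r, 0 < r → μ.real (ball x r) ≤ D * r ^ n) (hg : Continuous g)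
    (hc : HasCompactSupport g) (hg0 : ∀ p, 0 ≤ g p)
    (hI : ∀ v, ∫ p, |g (p + v) - g p| ≤ ‖v‖ * I) :
    ∫ p, g p ∂μ ≤ 2 ^ (n + 2) * (n + 2) ^ n * (n + 1) * D * I := by
  obtain ⟨R, hR, hsupp⟩ : ∃ R > 0, ∀ p, g p ≠ 0 → ∀ i, |p i| < R := by
    obtain ⟨R, hR, h⟩ := hc.isCompact.isBounded.subset_ball_lt 0 0
    refine ⟨R, hR, fun p hp i => ?_⟩
    have := mem_ball_zero_iff.1 (h (subset_tsupport g hp))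
    exact (PiLp.norm_apply_le p i).trans_lt this
  have hgi : Integrable g := hg.integrable_of_hasCompactSupport hc
  have hgμ : Integrable g μ := hg.integrable_of_hasCompactSupport hc
  set B := D * ((n + 2) * (4 * R)) ^ n with hB
  suffices h : ∀ ε > 0, ∫ p, g p ∂μ ≤ 2 ^ (n + 2) * (n + 2) ^ n * (n + 1) * D * I + ε * B by
    have hlim : Filter.Tendsto (fun ε : ℝ => 2 ^ (n + 2) * (n + 2) ^ n * (n + 1) * D * I + ε * B)
        (nhdsWithin 0 (Set.Ioi 0)) (nhds (2 ^ (n + 2) * (n + 2) ^ n * (n + 1) * D * I)) := by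
      refine (Continuous.tendsto' (by fun_prop) 0 _ (by simp)).mono_left nhdsWithin_le_nhds
    exact ge_of_tendsto hlim (eventually_mem_nhdsWithin.mono h)
  intro ε hε
  obtain ⟨η, hη, hgη⟩ :=
    Metric.uniformContinuous_iff.1 (hc.uniformContinuous_of_continuous hg) ε hε
  obtain ⟨j, hj⟩ := pow_unbounded_of_one_lt ((n + 1) * (2 * R) / η) (one_lt_two (α := ℝ))
  set δ := 2 * R / 2 ^ j with hδ_def
  have hδ : 0 < δ := by positivity
  have hjδ : 2 ^ j * δ = 2 * R := by rw [hδ_def]; field_simp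
  have hδη : (n + 1) * δ < η := by
    rw [div_lt_iff₀ hη] at hj
    rw [hδ_def, ← mul_div_assoc, div_lt_iff₀ (by positivity)]
    linarith
  have hosc : ∀ p q, dist p q ≤ Fintype.card ι * δ → g p ≤ g q + ε := by
    intro p q hpq
    rw [hd] at hpq
    push_cast at hpq
    have := hgη (hpq.trans_lt hδη)
    rw [Real.dist_eq] at this
    linarith [(abs_lt.1 this).2]
  set Q : Finset (ι → ℤ) := latticeCube 0 (2 ^ (j + 1)) with hQ
  have hzero : ∀ p ∉ gridIndex δ R ⁻¹' (Q : Set (ι → ℤ)), g p = 0 := by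
    intro p hp
    by_contra hgp
    refine hp ?_
    rw [Set.mem_preimage, Finset.mem_coe, hQ, gridIndex_mem_latticeCube_iff hδ]
    intro i
    have := abs_lt.1 (hsupp p hgp i)
    rw [pow_succ]
    push_cast
    simp only [Pi.zero_apply, Int.cast_zero, zero_mul, zero_add, mul_right_comm _ _ δ, hjδ]
    constructor <;> linarith
  have hfin := fun x => finite_gridIndex_preimage_singleton hδ R μ x
  calc ∫ p, g p ∂μ = ∑ x ∈ Q, ∫ p in gridIndex δ R ⁻¹' {x}, g p ∂μ := by
        rw [sum_setIntegral_gridIndex_preimage δ R hgμ,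
          setIntegral_eq_integral_of_forall_compl_eq_zero hzero]
    _ ≤ ∑ x ∈ Q, (gridAverage δ R g x + ε) * μ.real (gridIndex δ R ⁻¹' {x}) := by
        refine Finset.sum_le_sum fun x _ => ?_
        rw [mul_comm, ← smul_eq_mul, ← setIntegral_const]
        refine setIntegral_mono_on hgμ.integrableOn (integrableOn_const (hfin x).ne)
          (measurableSet_gridIndex_preimage δ R x) ?_
        rintro p rfl
        exact le_gridAverage_add hδ hgi hosc p
    _ = ∑ x ∈ Q, gridAverage δ R g x * μ.real (gridIndex δ R ⁻¹' {x}) +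
          ε * μ.real (gridIndex δ R ⁻¹' (Q : Set (ι → ℤ))) := by
        simp only [add_mul, Finset.sum_add_distrib, ← Finset.mul_sum]
        rw [sum_measureReal_preimage_singleton _
          (fun x _ => measurableSet_gridIndex_preimage δ R x) (fun x _ => (hfin x).ne)]
    _ ≤ _ := by
        gcongr
        · exact sum_gridAverage_mul_measureReal_le hd hμ hgi hg0 hI hδ j hjδ hsupp
        · refine (measureReal_gridIndex_preimage_le hδ R hμ 0 (by positivity)).trans_eq ?_
          rw [hd, pow_succ, hB]
          push_cast
          rw [mul_right_comm _ _ δ, hjδ]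
          ring

end MeyersZiemer

/-- Meyers–Ziemer inequality: for every `n ≥ 1` there is a constant
`C > 0` depending only on `n` such that for every Radon measure `μ` on ℝ^{n+1}
with finite density-ratio supremum `𝔇(μ) = sup μ(B_r(x))/rⁿ` and every
`φ ∈ C¹_c(ℝ^{n+1})`, `∫ φ dμ ≤ C · 𝔇(μ) · ∫ |∇φ| dx`. -/
theorem statement3 (n : ℕ) (hn : 1 ≤ n) :
    ∃ C : ℝ, 0 < C ∧
      ∀ μ : Measure (EuclideanSpace ℝ (Fin (n + 1))), IsLocallyFiniteMeasure μ →
        BddAbove {q : ℝ | ∃ (x : EuclideanSpace ℝ (Fin (n + 1))) (r : ℝ), 0 < r ∧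
            q = (μ (ball x r)).toReal / r ^ n} →
        ∀ φ : EuclideanSpace ℝ (Fin (n + 1)) → ℝ, ContDiff ℝ 1 φ → HasCompactSupport φ →
          ∫ x, φ x ∂μ ≤
            C * sSup {q : ℝ | ∃ (x : EuclideanSpace ℝ (Fin (n + 1))) (r : ℝ), 0 < r ∧
                q = (μ (ball x r)).toReal / r ^ n} *
              ∫ x, ‖fderiv ℝ φ x‖ := by
  refine ⟨2 ^ (n + 2) * (n + 2) ^ n * (n + 1), by positivity, fun μ hμ hbdd φ hφ hc => ?_⟩
  have hcont := hφ.continuous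
  have hφi : Integrable φ := hcont.integrable_of_hasCompactSupport hc
  refine (integral_mono (hcont.integrable_of_hasCompactSupport hc)
    (hcont.integrable_of_hasCompactSupport hc).abs fun p => le_abs_self (φ p)).trans
    (integral_le_of_integral_abs_sub_translate_le (by simp) (fun x r hr => ?_) hcont.abs hc.norm
      (fun p => abs_nonneg (φ p)) fun v => ?_)
  · rw [← div_le_iff₀ (by positivity)]
    exact le_csSup hbdd ⟨x, r, hr, rfl⟩
  · refine (integral_mono ?_ ?_ fun p => abs_abs_sub_abs_le (φ (p + v)) (φ p)).trans
      (integral_abs_sub_translate_le volume hφ hc v)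
    · exact ((hφi.comp_add_right v).abs.sub hφi.abs).abs
    · exact ((hφi.comp_add_right v).sub hφi).abs
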